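/- Let K be a field of characteristic zero and let f be a K-algebra endomorphism of K[x,y]. Suppose there exist elements s and k in the image T of f such that s is symmetric with respect to the exchange involution α (α(s) = s), k is skew-symmetric with respect to α (α(k) = −k), and Jac(s,k) is a nonzero element of K. Then f is a K-algebra automorphism of K[x,y]. -/

import Mathlib

open MvPolynomial

/-- The Jacobian of two polynomials in `K[x,y]` (variables indexed by `Fin 2`). -/
noncomputable def Jac {K : Type*} [CommRing K]
    (P Q : MvPolynomial (Fin 2) K) : MvPolynomial (Fin 2) K :=
  pderiv 0 P * pderiv 1 Q - pderiv 1 P * pderiv 0 Q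

/-- The exchange involution `α` on `K[x,y]`, swapping the two variables. -/
noncomputable def exch (K : Type*) [CommSemiring K] :
    MvPolynomial (Fin 2) K ≃ₐ[K] MvPolynomial (Fin 2) K :=
  MvPolynomial.renameEquiv K (Equiv.swap 0 1)

/-- An involution on a `K`-algebra: an algebra automorphism of order 2. -/
def IsInvolution {K R : Type*} [CommSemiring K] [Semiring R] [Algebra K R]
    (γ : R ≃ₐ[K] R) : Prop :=
  (∀ p, γ (γ p) = p) ∧ γ ≠ AlgEquiv.refl

open MvPolynomial

theorem coeff_X_mul_pderiv' {K : Type*} [Field K] (i : Fin 2) (p : MvPolynomial (Fin 2) K)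
    (m : Fin 2 →₀ ℕ) : coeff m (X i * pderiv i p) = (m i : K) * coeff m p := by
  classical
  induction p using MvPolynomial.induction_on' with
  | monomial n a =>
    rw [X_mul_pderiv_monomial, coeff_smul, coeff_monomial]
    split_ifs with h
    · subst h; simp
    · simp
  | add p q hp hq => simp only [map_add, mul_add, coeff_add, hp, hq]

theorem coeff_mul_uniq {K : Type*} [Field K] (A B P Q : MvPolynomial (Fin 2) K)
    (hA : ∀ m, coeff m P = 0 → coeff m A = 0) (hB : ∀ m, coeff m Q = 0 → coeff m B = 0)
    (m n : Fin 2 →₀ ℕ)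
    (hu : ∀ m' n', coeff m' P ≠ 0 → coeff n' Q ≠ 0 → m' + n' = m + n → m' = m ∧ n' = n) :
    coeff (m + n) (A * B) = coeff m A * coeff n B := by
  classical
  rw [coeff_mul]
  refine Finset.sum_eq_single (m, n) ?_ ?_
  · rintro ⟨m', n'⟩ h1 h2
    rw [Finset.HasAntidiagonal.mem_antidiagonal] at h1
    by_contra h3
    have := hu m' n' (fun h => h3 (by simp [hA _ h])) (fun h => h3 (by simp [hB _ h])) h1
    exact h2 (by rw [this.1, this.2])
  · intro h; simp at h

theorem key_lemma {K : Type*} [Field K] [CharZero K] (P Q : MvPolynomial (Fin 2) K) (c : K)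
    (hJ : Jac P Q = C c) (m n : Fin 2 →₀ ℕ) (hm : coeff m P ≠ 0) (hn : coeff n Q ≠ 0)
    (hu : ∀ m' n', coeff m' P ≠ 0 → coeff n' Q ≠ 0 → m' + n' = m + n → m' = m ∧ n' = n)
    (hd : m 0 * n 1 ≠ m 1 * n 0) : m 0 + n 0 = 1 ∧ m 1 + n 1 = 1 := by
  classical
  have e : (X 0 * pderiv 0 P) * (X 1 * pderiv 1 Q) - (X 1 * pderiv 1 P) * (X 0 * pderiv 0 Q)
      = monomial (Finsupp.single 0 1 + Finsupp.single 1 1) c := by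
    have : monomial (Finsupp.single 0 1 + Finsupp.single 1 1) c
      = (X 0 * X 1 * C c : MvPolynomial (Fin 2) K) := by
      rw [mul_comm, X, X, monomial_mul, C_mul_monomial]; simp
    rw [this, ← hJ, Jac]; ring
  have hz : ∀ (i : Fin 2) (R : MvPolynomial (Fin 2) K) m, coeff m R = 0 →
      coeff m (X i * pderiv i R) = 0 := by
    intro i R m h; rw [coeff_X_mul_pderiv', h, mul_zero]
  have e2 := congrArg (coeff (m + n)) e
  rw [coeff_sub, coeff_mul_uniq _ _ P Q (hz 0 P) (hz 1 Q) m n hu,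
    coeff_mul_uniq _ _ P Q (hz 1 P) (hz 0 Q) m n hu, coeff_monomial] at e2
  simp only [coeff_X_mul_pderiv'] at e2
  split_ifs at e2 with h
  · have h0 := DFunLike.congr_fun h 0
    have h1 := DFunLike.congr_fun h 1
    simp at h0 h1
    omega
  · exfalso
    have : ((m 0 : K) * n 1 - m 1 * n 0) * (coeff m P * coeff n Q) = 0 := by
      rw [← e2]; ring
    rcases mul_eq_zero.1 this with h | h
    · apply hd
      have := sub_eq_zero.1 h
      exact_mod_cast this
    · exact mul_ne_zero hm hn h

theorem ext2 {m n : Fin 2 →₀ ℕ} (h0 : m 0 = n 0) (h1 : m 1 = n 1) : m = n := by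
  ext i; fin_cases i <;> assumption

/-- The core: a Keller pair with `v ∣ Q`. -/
theorem core {K : Type*} [Field K] [CharZero K] (P Q : MvPolynomial (Fin 2) K) (c : K)
    (hc : c ≠ 0) (hJ : Jac P Q = C c) (hQ : ∀ m, coeff m Q ≠ 0 → 1 ≤ m 1) :
    coeff (Finsupp.single 0 1) P ≠ 0 ∧ coeff (Finsupp.single 1 1) Q ≠ 0 ∧
    (∀ m, coeff m P ≠ 0 → m 0 = 0 ∨ m = Finsupp.single 0 1) ∧
    (∀ m, coeff m Q ≠ 0 → m = Finsupp.single 1 1) := by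
  classical
  have hpq : coeff (Finsupp.single 0 1) P * coeff (Finsupp.single 1 1) Q = c := by
    have hq : coeff (Finsupp.single 0 1) Q = 0 := by
      by_contra h
      have := hQ _ h
      simp at this
    have h := congrArg (coeff 0) hJ
    have hcd : ∀ (i : Fin 2) (R : MvPolynomial (Fin 2) K),
        coeff 0 (pderiv i R) = coeff (Finsupp.single i 1) R := by
      intro i R
      have h1 := coeff_X_mul_pderiv' i R (Finsupp.single i 1)
      have h2 := coeff_X_mul (0 : Fin 2 →₀ ℕ) i (pderiv i R)
      rw [add_zero] at h2
      rw [← h2, h1]; simp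
    have hm0 : ∀ A B : MvPolynomial (Fin 2) K, coeff 0 (A * B) = coeff 0 A * coeff 0 B := by
      intro A B; simp [← constantCoeff_eq]
    rw [Jac, coeff_sub, hm0, hm0, hcd, hcd, hcd, hcd, hq] at h
    simpa using h
  have hp1 : coeff (Finsupp.single 0 1) P ≠ 0 := by
    intro h; rw [h, zero_mul] at hpq; exact hc hpq.symm
  have hq1 : coeff (Finsupp.single 1 1) Q ≠ 0 := by
    intro h; rw [h, mul_zero] at hpq; exact hc hpq.symm
  refine ⟨hp1, hq1, ?_⟩
  -- restriction to the line
  have hline : (∀ m, coeff m P ≠ 0 → m 1 = 0 → m 0 ≤ 1) ∧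
      (∀ m, coeff m Q ≠ 0 → m 1 = 1 → m 0 = 0) := by
    obtain ⟨m, hm, hmmax⟩ := Finset.exists_max_image (P.support.filter (fun m => m 1 = 0))
      (fun m => m 0) ⟨Finsupp.single 0 1, by simp [hp1]⟩
    obtain ⟨n, hn, hnmax⟩ := Finset.exists_max_image (Q.support.filter (fun m => m 1 = 1))
      (fun m => m 0) ⟨Finsupp.single 1 1, by simp [hq1]⟩
    simp only [Finset.mem_filter, mem_support_iff] at hm hn hmmax hnmax
    have hm1 : 1 ≤ m 0 := by
      have := hmmax (Finsupp.single 0 1) ⟨hp1, by simp⟩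
      simpa using this
    have := key_lemma P Q c hJ m n hm.1 hn.1 (by
      intro m' n' hm' hn' h
      have h0 := DFunLike.congr_fun h 0
      have h1 := DFunLike.congr_fun h 1
      simp only [Finsupp.add_apply] at h0 h1
      have a1 := hQ _ hn'
      have a2 := hmmax m' ⟨hm', by omega⟩
      have a3 := hnmax n' ⟨hn', by omega⟩
      exact ⟨ext2 (by omega) (by omega), ext2 (by omega) (by omega)⟩) (by
      rw [hm.2, hn.2]; omega)
    refine ⟨fun m' h1 h2 => ?_, fun m' h1 h2 => ?_⟩
    · have := hmmax m' ⟨h1, h2⟩; omega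
    · have := hnmax m' ⟨h1, h2⟩; omega
  obtain ⟨hl1, hl2⟩ := hline
  let S : Finset ℚ := insert 0 (P.support.image (fun m => ((m 0 : ℚ) - 1) / m 1) ∪
    Q.support.image (fun m => (m 0 : ℚ) / ((m 1 : ℚ) - 1)))
  obtain ⟨r, hrS, hrmax⟩ := Finset.exists_max_image S id ⟨0, by simp [S]⟩
  have hr0 : 0 ≤ r := hrmax 0 (by simp [S])
  have hPr : ∀ m, coeff m P ≠ 0 → (m 0 : ℚ) ≤ 1 + r * m 1 := by
    intro m hm
    rcases Nat.eq_zero_or_pos (m 1) with h | h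
    · have : (m 0 : ℚ) ≤ 1 := by exact_mod_cast hl1 m hm h
      simpa [h] using this
    · have h' : (0 : ℚ) < m 1 := by exact_mod_cast h
      have : ((m 0 : ℚ) - 1) / m 1 ≤ r := hrmax _ (by
        simp only [S, Finset.mem_insert, Finset.mem_union, Finset.mem_image]
        exact Or.inr (Or.inl ⟨m, by simpa using hm, rfl⟩))
      rw [div_le_iff₀ h'] at this
      linarith
  have hQr : ∀ m, coeff m Q ≠ 0 → (m 0 : ℚ) ≤ r * ((m 1 : ℚ) - 1) := by
    intro m hm
    rcases Nat.eq_or_lt_of_le (hQ m hm) with h | h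
    · have := hl2 m hm h.symm
      simp [← h, this]
    · have h' : (0 : ℚ) < (m 1 : ℚ) - 1 := by
        have : (1 : ℚ) < m 1 := by exact_mod_cast h
        linarith
      have : (m 0 : ℚ) / ((m 1 : ℚ) - 1) ≤ r := hrmax _ (by
        simp only [S, Finset.mem_insert, Finset.mem_union, Finset.mem_image]
        exact Or.inr (Or.inr ⟨m, by simpa using hm, rfl⟩))
      rwa [div_le_iff₀ h'] at this
  obtain ⟨m, hm, hmmax⟩ := Finset.exists_max_image
    (P.support.filter (fun m => (m 0 : ℚ) = 1 + r * m 1))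
    (fun m => m 1) ⟨Finsupp.single 0 1, by simp [hp1]⟩
  obtain ⟨n, hn, hnmax⟩ := Finset.exists_max_image
    (Q.support.filter (fun m => (m 0 : ℚ) = r * ((m 1 : ℚ) - 1)))
    (fun m => m 1) ⟨Finsupp.single 1 1, by simp [hq1]⟩
  simp only [Finset.mem_filter, mem_support_iff] at hm hn hmmax hnmax
  have hn1 := hQ n hn.1
  have hmn := key_lemma P Q c hJ m n hm.1 hn.1 (by
      intro m' n' hm' hn' h
      have h0 := DFunLike.congr_fun h 0
      have h1 := DFunLike.congr_fun h 1
      simp only [Finsupp.add_apply] at h0 h1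
      have h0' : (m' 0 : ℚ) + n' 0 = m 0 + n 0 := by exact_mod_cast h0
      have h1' : (m' 1 : ℚ) + n' 1 = m 1 + n 1 := by exact_mod_cast h1
      have h1r : r * (m' 1 : ℚ) + r * n' 1 = r * m 1 + r * n 1 := by
        rw [← mul_add, h1', mul_add]
      have b1 := hPr m' hm'
      have b2 := hQr n' hn'
      have b3 := hm.2
      have b4 := hn.2
      have a2 := hmmax m' ⟨hm', by linarith⟩
      have a3 := hnmax n' ⟨hn', by linarith⟩
      have c1 : m' 1 = m 1 := by omega
      have c2 : n' 1 = n 1 := by omega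
      rw [c1] at b1
      rw [c2] at b2
      have c3 : (m' 0 : ℚ) = m 0 := by linarith
      have c4 : m' 0 = m 0 := by exact_mod_cast c3
      exact ⟨ext2 (by omega) (by omega), ext2 (by omega) (by omega)⟩) (by
      intro h
      have h' : (m 0 : ℚ) * n 1 = m 1 * n 0 := by exact_mod_cast h
      rw [hm.2, hn.2] at h'
      have : (1 : ℚ) ≤ n 1 := by exact_mod_cast hn1
      have : 0 ≤ r * m 1 := by positivity
      nlinarith)
  have hr : r = 0 := by
    simp only [S, Finset.mem_insert, Finset.mem_union, Finset.mem_image] at hrS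
    rcases hrS with h | ⟨m', hm', h⟩ | ⟨m', hm', h⟩
    · exact h
    · rw [mem_support_iff] at hm'
      rcases Nat.eq_zero_or_pos (m' 1) with h1 | h1
      · rw [← h, h1]; simp
      · have h' : (m' 1 : ℚ) ≠ 0 := by exact_mod_cast h1.ne'
        rw [div_eq_iff h'] at h
        have := hmmax m' ⟨hm', by linarith⟩
        omega
    · rw [mem_support_iff] at hm'
      rcases Nat.eq_or_lt_of_le (hQ m' hm') with h1 | h1
      · rw [← h, ← h1]; simp
      · have h' : (m' 1 : ℚ) - 1 ≠ 0 := by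
          have : (1 : ℚ) < m' 1 := by exact_mod_cast h1
          linarith
        rw [div_eq_iff h'] at h
        have := hnmax m' ⟨hm', by linarith⟩
        omega
  subst hr
  simp only [zero_mul, add_zero] at *
  refine ⟨fun m' hm' => ?_, fun m' hm' => ?_⟩
  · have h1 : m' 0 ≤ 1 := by exact_mod_cast hPr m' hm'
    rcases Nat.eq_zero_or_pos (m' 0) with h | h
    · exact Or.inl h
    · right
      have h2 : m' 0 = 1 := by omega
      have := hmmax m' ⟨hm', by exact_mod_cast h2⟩
      exact ext2 (by simp [h2]) (by simp; omega)
  · have h1 : m' 0 = 0 := by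
      have : m' 0 ≤ 0 := by exact_mod_cast hQr m' hm'
      omega
    have := hnmax m' ⟨hm', by simp [h1]⟩
    have := hQ m' hm'
    exact ext2 (by simp [h1]) (by simp; omega)

theorem core_top {K : Type*} [Field K] [CharZero K] (P Q : MvPolynomial (Fin 2) K) (c : K)
    (hc : c ≠ 0) (hJ : Jac P Q = C c) (hQ : ∀ m, coeff m Q ≠ 0 → 1 ≤ m 1)
    (A : Subalgebra K (MvPolynomial (Fin 2) K)) (hPA : P ∈ A) (hQA : Q ∈ A) : A = ⊤ := by
  classical
  obtain ⟨hp, hq, hP', hQ'⟩ := core P Q c hc hJ hQ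
  have hX1 : (X 1 : MvPolynomial (Fin 2) K) ∈ A := by
    have : (X 1 : MvPolynomial (Fin 2) K) = (coeff (Finsupp.single 1 1) Q)⁻¹ • Q := by
      ext m
      rw [coeff_smul, coeff_X, smul_eq_mul]
      split_ifs with h
      · rw [← h, inv_mul_cancel₀ hq]
      · by_cases h2 : coeff m Q = 0
        · rw [h2, mul_zero]
        · exact absurd (hQ' m h2).symm h
    rw [this]; exact A.smul_mem hQA _
  have hX0 : (X 0 : MvPolynomial (Fin 2) K) ∈ A := by
    have h1 : P - monomial (Finsupp.single 0 1) (coeff (Finsupp.single 0 1) P) ∈ A := by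
      rw [← support_sum_monomial_coeff (P - monomial (Finsupp.single 0 1) (coeff (Finsupp.single 0 1) P))]
      refine A.sum_mem fun m hm => ?_
      rw [mem_support_iff, coeff_sub, coeff_monomial] at hm
      have hm0 : m 0 = 0 := by
        split_ifs at hm with h
        · rw [h, sub_self] at hm; exact absurd rfl hm
        · rw [sub_zero] at hm
          rcases hP' m hm with h2 | h2
          · exact h2
          · exact absurd h2.symm h
      rw [monomial_eq, Finsupp.prod_fintype _ _ (by simp)]
      simp only [Fin.prod_univ_two, hm0, pow_zero, one_mul]
      exact A.mul_mem (A.algebraMap_mem _) (A.pow_mem hX1 _)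
    have h2 : (X 0 : MvPolynomial (Fin 2) K) = (coeff (Finsupp.single 0 1) P)⁻¹ •
        monomial (Finsupp.single 0 1) (coeff (Finsupp.single 0 1) P) := by
      rw [smul_monomial, smul_eq_mul, inv_mul_cancel₀ hp]; rfl
    rw [h2]
    refine A.smul_mem ?_ _
    have := A.sub_mem hPA h1
    rwa [sub_sub_cancel] at this
  rw [eq_top_iff, ← adjoin_range_X, Algebra.adjoin_le_iff]
  rintro _ ⟨i, rfl⟩
  fin_cases i
  · exact hX0
  · exact hX1

/-- chain rule -/
theorem pderiv_aeval2 {K : Type*} [Field K] (g : MvPolynomial (Fin 2) K →ₐ[K] MvPolynomial (Fin 2) K)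
    (i : Fin 2) (p : MvPolynomial (Fin 2) K) :
    pderiv i (g p) = g (pderiv 0 p) * pderiv i (g (X 0)) + g (pderiv 1 p) * pderiv i (g (X 1)) := by
  induction p using MvPolynomial.induction_on with
  | C a =>
    have : g (C a) = C a := g.commutes a
    rw [this]; simp
  | add p q hp hq => simp only [map_add, hp, hq]; ring
  | mul_X p j hp =>
    fin_cases j <;> simp [Derivation.leibniz, hp, pderiv_X] <;> ring

theorem Jac_map {K : Type*} [Field K] (g : MvPolynomial (Fin 2) K →ₐ[K] MvPolynomial (Fin 2) K)
    (p q : MvPolynomial (Fin 2) K) :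
    Jac (g p) (g q) = g (Jac p q) * Jac (g (X 0)) (g (X 1)) := by
  simp only [Jac, pderiv_aeval2 g _ p, pderiv_aeval2 g _ q, map_sub, map_mul]; ring

theorem coeff_flip {K : Type*} [Field K] (p : MvPolynomial (Fin 2) K) (m : Fin 2 →₀ ℕ) :
    coeff m (aeval (![X 0, -X 1] : Fin 2 → MvPolynomial (Fin 2) K) p)
      = (-1) ^ (m 1) * coeff m p := by
  classical
  induction p using MvPolynomial.induction_on' with
  | monomial n a =>
    have : aeval (![X 0, -X 1] : Fin 2 → MvPolynomial (Fin 2) K) (monomial n a)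
        = C ((-1) ^ (n 1)) * monomial n a := by
      rw [aeval_monomial, monomial_eq, Finsupp.prod_fintype _ _ (by simp),
        Finsupp.prod_fintype _ _ (by simp)]
      simp [Fin.prod_univ_two, neg_pow (X 1 : MvPolynomial (Fin 2) K), algebraMap_eq]
      ring
    rw [this, coeff_C_mul, coeff_monomial]
    split_ifs with h
    · rw [h]
    · simp
  | add p q hp hq => simp only [map_add, mul_add, coeff_add, hp, hq]

theorem inj_of_surj_endo {R : Type*} [CommRing R] [IsNoetherianRing R] (f : R →+* R)
    (hf : Function.Surjective f) : Function.Injective f := by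
  have hit : ∀ n x, (f ^ n) x = f^[n] x := fun n x => by rw [RingHom.coe_pow]
  let g : ℕ →o Ideal R := ⟨fun n => RingHom.ker (f ^ n), by
    refine monotone_nat_of_le_succ fun n x hx => ?_
    rw [RingHom.mem_ker, hit] at hx ⊢
    rw [Function.iterate_succ_apply', hx, map_zero]⟩
  obtain ⟨n, hn⟩ := monotone_stabilizes_iff_noetherian.2 ‹IsNoetherianRing R› g
  rw [injective_iff_map_eq_zero]
  intro x hx
  obtain ⟨y, rfl⟩ := hf.iterate n x
  have h1 : y ∈ g (n + 1) := by
    change y ∈ RingHom.ker (f ^ (n + 1))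
    rw [RingHom.mem_ker, hit, Function.iterate_succ_apply', hx]
  rw [← hn (n + 1) (Nat.le_succ n)] at h1
  change y ∈ RingHom.ker (f ^ n) at h1
  rwa [RingHom.mem_ker, hit] at h1

/-- If the image of `f` contains an `α`-symmetric `s` and an `α`-skew-symmetric
`k` with `Jac(s,k)` a nonzero scalar, then `f` is an automorphism. -/
theorem stmt18 {K : Type*} [Field K] [CharZero K]
    (f : MvPolynomial (Fin 2) K →ₐ[K] MvPolynomial (Fin 2) K)
    (h : ∃ s k : MvPolynomial (Fin 2) K, s ∈ f.range ∧ k ∈ f.range ∧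
      exch K s = s ∧ exch K k = -k ∧ ∃ c : K, c ≠ 0 ∧ Jac s k = C c) :
    Function.Bijective f := by
  obtain ⟨s, k, hs, hk, -, hk', c, hc, hJ⟩ := h
  have h2 : (2 : K) ≠ 0 := two_ne_zero
  let ψ : MvPolynomial (Fin 2) K →ₐ[K] MvPolynomial (Fin 2) K := aeval ![X 0 + X 1, X 0 - X 1]
  let χ : MvPolynomial (Fin 2) K →ₐ[K] MvPolynomial (Fin 2) K :=
    aeval ![C (2⁻¹) * (X 0 + X 1), C (2⁻¹) * (X 0 - X 1)]
  have hCC : (C (2⁻¹ : K) : MvPolynomial (Fin 2) K) * 2 = 1 := by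
    have : (2 : MvPolynomial (Fin 2) K) = C 2 := (map_ofNat C 2).symm
    rw [this, ← C_mul, inv_mul_cancel₀ h2, C_1]
  have hinv : χ.comp ψ = AlgHom.id K _ := by
    apply algHom_ext
    intro i
    fin_cases i
    · simp [ψ, χ]; linear_combination (X 0) * hCC
    · simp [ψ, χ]; linear_combination (X 1) * hCC
  have hψinj : Function.Injective ψ := by
    intro a b hab
    have := congrArg χ hab
    have e : ∀ a, χ (ψ a) = a := fun a => DFunLike.congr_fun hinv a
    rwa [e, e] at this
  have hcomm : ∀ p, ψ (exch K p) = aeval (![X 0, -X 1] : Fin 2 → MvPolynomial (Fin 2) K) (ψ p) := by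
    have : ψ.comp (exch K : MvPolynomial (Fin 2) K →ₐ[K] MvPolynomial (Fin 2) K)
        = (aeval (![X 0, -X 1] : Fin 2 → MvPolynomial (Fin 2) K)).comp ψ := by
      apply algHom_ext
      intro i
      fin_cases i <;> simp [ψ, exch] <;> ring
    exact fun p => DFunLike.congr_fun this p
  have hJ' : Jac (ψ s) (ψ k) = C (c * (-2)) := by
    rw [Jac_map, hJ]
    have h1 : ψ (C c) = C c := ψ.commutes c
    have h3 : Jac (ψ (X 0)) (ψ (X 1)) = C (-2) := by
      simp [ψ, Jac, pderiv_X]; norm_num; exact (map_ofNat C 2).symm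
    rw [h1, h3, C_mul]
  have hQ : ∀ m, coeff m (ψ k) ≠ 0 → 1 ≤ m 1 := by
    intro m hm
    by_contra h0
    have h0' : m 1 = 0 := by omega
    have e := coeff_flip (ψ k) m
    rw [← hcomm, hk', map_neg, coeff_neg, h0', pow_zero, one_mul] at e
    have : 2 * coeff m (ψ k) = 0 := by linear_combination -e
    exact (mul_ne_zero h2 hm) this
  have htop := core_top (ψ s) (ψ k) _ (mul_ne_zero hc (neg_ne_zero.2 h2)) hJ' hQ (ψ.comp f).range
    (by obtain ⟨a, rfl⟩ := hs; exact ⟨a, rfl⟩) (by obtain ⟨a, rfl⟩ := hk; exact ⟨a, rfl⟩)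
  have hsurj : Function.Surjective f := by
    intro b
    have : ψ b ∈ (ψ.comp f).range := by rw [htop]; trivial
    obtain ⟨a, ha⟩ := this
    exact ⟨a, hψinj ha⟩
  exact ⟨fun a b hab => inj_of_surj_endo f.toRingHom hsurj hab, hsurj⟩
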